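/- Let $n\ge 2$ be a natural number, let $\varnothing\ge 2$ be a real number, and let $r$ be a natural number with $4r\le\varnothing$. For $0\le i\le r-1$ define $c_i = \dfrac{16\ln n}{\varnothing}\,(\varnothing/2)^{1/2^i}$. Then $\max_{0\le i\le r-1} c_i \le 8\ln n$, $\sum_{i=0}^{r-1} c_i \le 32\ln n$, and $\sum_{i=0}^{r-1} c_i^2 \le 256(\ln n)^2$. -/

import Mathlib

/-- Bounds on the constants `cᵢ = (16 ln n / φ) * (φ/2)^(1/2^i)` arising in Phase 1 of
the analysis of Randomized Local Search: if `n ≥ 2`, `φ ≥ 2` and `4r ≤ φ`, then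
`max_{0 ≤ i ≤ r-1} cᵢ ≤ 8 ln n`, `∑_{i=0}^{r-1} cᵢ ≤ 32 ln n` and
`∑_{i=0}^{r-1} cᵢ² ≤ 256 (ln n)²`. -/
theorem phase1_constants_bounds (n : ℕ) (hn : 2 ≤ n) (φ : ℝ) (hφ : 2 ≤ φ)
    (r : ℕ) (hr : 4 * (r : ℝ) ≤ φ)
    (c : ℕ → ℝ) (hc : ∀ i : ℕ, c i = 16 * Real.log n / φ * (φ / 2) ^ ((1 : ℝ) / 2 ^ i)) :
    (∀ i ∈ Finset.range r, c i ≤ 8 * Real.log n) ∧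
    (∑ i ∈ Finset.range r, c i ≤ 32 * Real.log n) ∧
    (∑ i ∈ Finset.range r, (c i) ^ 2 ≤ 256 * (Real.log n) ^ 2) := by
  have hL : 0 ≤ Real.log n := Real.log_natCast_nonneg n
  have hφ0 : 0 < φ := by linarith
  have ha1 : ∀ i : ℕ, (1 : ℝ) / 2 ^ i ≤ 1 := fun i => by
    rw [div_le_one (by positivity)]
    exact one_le_pow₀ (by norm_num)
  have hk0 : 0 ≤ 16 * Real.log n / φ := by positivity
  have hb : ∀ i : ℕ, (φ / 2) ^ ((1 : ℝ) / 2 ^ i) ≤ 1 + (1 : ℝ) / 2 ^ i * (φ / 2 - 1) := fun i => by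
    have h := rpow_one_add_le_one_add_mul_self (s := φ / 2 - 1) (by linarith)
      (p := (1 : ℝ) / 2 ^ i) (by positivity) (ha1 i)
    rwa [add_sub_cancel] at h
  have h1 : ∀ i : ℕ, c i ≤ 8 * Real.log n := fun i => by
    have h2 : (φ / 2) ^ ((1 : ℝ) / 2 ^ i) ≤ φ / 2 := by
      have := hb i
      nlinarith [ha1 i]
    calc c i ≤ 16 * Real.log n / φ * (φ / 2) := by
          rw [hc]; exact mul_le_mul_of_nonneg_left h2 hk0
      _ = 8 * Real.log n := by field_simp; ring
  have h0 : ∀ i : ℕ, 0 ≤ c i := fun i => by rw [hc]; positivity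
  have hg : ∀ m : ℕ, ∑ i ∈ Finset.range m, (1 : ℝ) / 2 ^ i ≤ 2 := fun m => by
    have : ∑ i ∈ Finset.range m, (1 : ℝ) / 2 ^ i = 2 - 2 / 2 ^ m := by
      induction m with
      | zero => norm_num
      | succ k ih => rw [Finset.sum_range_succ, ih, pow_succ]; field_simp; ring
    rw [this]
    have : (0 : ℝ) ≤ 2 / 2 ^ m := by positivity
    linarith
  have hs : ∑ i ∈ Finset.range r, (φ / 2) ^ ((1 : ℝ) / 2 ^ i) ≤ 2 * φ := by
    calc _ ≤ ∑ i ∈ Finset.range r, (1 + (1 : ℝ) / 2 ^ i * (φ / 2 - 1)) :=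
          Finset.sum_le_sum fun i _ => hb i
      _ = r + (∑ i ∈ Finset.range r, (1 : ℝ) / 2 ^ i) * (φ / 2 - 1) := by
          rw [Finset.sum_add_distrib, Finset.sum_mul]; simp
      _ ≤ 2 * φ := by nlinarith [hg r]
  have h2 : ∑ i ∈ Finset.range r, c i ≤ 32 * Real.log n := by
    calc _ = 16 * Real.log n / φ * ∑ i ∈ Finset.range r, (φ / 2) ^ ((1 : ℝ) / 2 ^ i) := by
          rw [Finset.mul_sum]; exact Finset.sum_congr rfl fun i _ => hc i
      _ ≤ 16 * Real.log n / φ * (2 * φ) := mul_le_mul_of_nonneg_left hs hk0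
      _ = 32 * Real.log n := by field_simp; ring
  refine ⟨fun i _ => h1 i, h2, ?_⟩
  calc _ ≤ ∑ i ∈ Finset.range r, 8 * Real.log n * c i :=
        Finset.sum_le_sum fun i _ => by nlinarith [h0 i, h1 i]
    _ = 8 * Real.log n * ∑ i ∈ Finset.range r, c i := by rw [Finset.mul_sum]
    _ ≤ 8 * Real.log n * (32 * Real.log n) := mul_le_mul_of_nonneg_left h2 (by positivity)
    _ = _ := by ring
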